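/- Let N, n ∈ ℕ, p ≥ 2, i ∈ {1,…,N}^p, c ∈ ℝ, and let H₀ : Σ_N → ℝ be any Hamiltonian; for x ∈ ℝ define H_x(σ) = H₀(σ) + c·x·σ_i. Then for every F : Σ_N^n → ℝ and every m ≥ 1, d/dx ⟨S_i^{m,n} F⟩_{H_x} = c·( −m(m−1) ⟨S_i^{m−1,n} F⟩_{H_x} + ⟨S_i^{m+1,n} F⟩_{H_x} ). -/

import Mathlib

open Filter

noncomputable section

/-- The configuration space `Σ_N = {-1,1}^N`, encoded by booleans. -/
abbrev Spin (N : ℕ) := Fin N → Bool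

/-- The real spin value `σ_i ∈ {-1,1}` at site `i`. -/
def spin {N : ℕ} (σ : Spin N) (i : Fin N) : ℝ := if σ i then 1 else -1

/-- For `i = (i₁,…,i_p)`, the product `σ_i = σ_{i₁} ⋯ σ_{i_p}`. -/
def spinProd {N p : ℕ} (σ : Spin N) (i : Fin p → Fin N) : ℝ := ∏ j, spin σ (i j)

/-- The partition function `Z(H)`. -/
def partitionZ {N : ℕ} (H : Spin N → ℝ) : ℝ := ∑ τ : Spin N, Real.exp (H τ)

/-- The Gibbs measure `G_H({σ}) = e^{H(σ)}/Z(H)`. -/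
def gibbs {N : ℕ} (H : Spin N → ℝ) (σ : Spin N) : ℝ := Real.exp (H σ) / partitionZ H

/-- The Gibbs expectation `⟨F⟩_H` of a function of `n` replicas. -/
def gibbsExp {N n : ℕ} (H : Spin N → ℝ) (F : (Fin n → Spin N) → ℝ) : ℝ :=
  ∑ σ : Fin n → Spin N, F σ * ∏ ℓ, gibbs H (σ ℓ)

/-- The multiplication operator `D_i` of (2.1):
`D_i F(σ¹,…,σ^{n+1}) = (∑_{ℓ=1}^n σ_i^ℓ - n σ_i^{n+1}) F(σ¹,…,σⁿ)`. -/
def Dop {N p : ℕ} (i : Fin p → Fin N) {n : ℕ} (F : (Fin n → Spin N) → ℝ)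
    (σ : Fin (n + 1) → Spin N) : ℝ :=
  ((∑ ℓ : Fin n, spinProd (σ ℓ.castSucc) i) - n * spinProd (σ (Fin.last n)) i) *
    F fun ℓ => σ ℓ.castSucc

/-- The `m`-fold iterate `D_i^m F`, a function of `n + m` replicas. -/
def DopIter {N p : ℕ} (i : Fin p → Fin N) {n : ℕ} :
    (m : ℕ) → ((Fin n → Spin N) → ℝ) → (Fin (n + m) → Spin N) → ℝ
  | 0, F => F
  | m + 1, F => Dop i (DopIter i m F)

/-- Extension of a finite replica family to an infinite one (junk beyond index `r`). -/
def extendReplicas {N r : ℕ} (σ : Fin r → Spin N) : ℕ → Spin N :=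
  fun j => if hj : j < r then σ ⟨j, hj⟩ else fun _ => true

/-- The functions `S_i^{m,n}` of (4.1), for an integer superscript `m` (zero if `m ≤ 0`):
`S_i^{m,n} = m! ∑_{k=0}^m (-1)^{m-k} C(n+m-k-1, n-1)
  ∑_{1≤ℓ₁<⋯<ℓ_k≤n} σ_i^{ℓ₁}⋯σ_i^{ℓ_k} σ_i^{n+1}⋯σ_i^{n+m-k}`. -/
def Sfun {N p : ℕ} (i : Fin p → Fin N) (n : ℕ) (m : ℤ) (σ : ℕ → Spin N) : ℝ :=
  if 1 ≤ m then
    (Nat.factorial m.toNat : ℝ) * ∑ k ∈ Finset.range (m.toNat + 1),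
      (-1 : ℝ) ^ (m.toNat - k) * (Nat.choose (n + m.toNat - k - 1) (n - 1) : ℝ) *
        ∑ T ∈ Finset.powersetCard k (Finset.univ : Finset (Fin n)),
          (∏ ℓ ∈ T, spinProd (σ (ℓ : ℕ)) i) *
            ∏ j ∈ Finset.Ico n (n + m.toNat - k), spinProd (σ j) i
  else 0

/-- The integer array `A(m,a)` defined recursively by `A(m,0) = 0`, `A(1,a) = 1_{a=1}` and
`A(m+1,a) = -(m-2a+4)(m-2a+3) A(m,a-1) + A(m,a)` for `m, a ≥ 1`. -/
def Aarr : ℕ → ℕ → ℤ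
  | _, 0 => 0
  | 0, _ + 1 => 0
  | 1, a + 1 => if a = 0 then 1 else 0
  | m + 2, a + 1 =>
      -(((m : ℤ) + 1) - 2 * ((a : ℤ) + 1) + 4) * (((m : ℤ) + 1) - 2 * ((a : ℤ) + 1) + 3)
          * Aarr (m + 1) a + Aarr (m + 1) (a + 1)

/-- The elementary symmetric sum `∑_{T ⊆ S, |T| = k} ∏_{ℓ ∈ T} s ℓ`. -/
def esymmSum {ι : Type*} (S : Finset ι) (s : ι → ℝ) (k : ℕ) : ℝ :=
  ∑ T ∈ S.powersetCard k, ∏ ℓ ∈ T, s ℓ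

lemma esymmSum_zero {ι : Type*} (S : Finset ι) (s : ι → ℝ) : esymmSum S s 0 = 1 := by
  simp [esymmSum]

lemma esymmSum_insert {ι : Type*} [DecidableEq ι] {S : Finset ι} {a : ι} (ha : a ∉ S)
    (s : ι → ℝ) (k : ℕ) :
    esymmSum (insert a S) s (k + 1) = esymmSum S s (k + 1) + s a * esymmSum S s k := by
  have haT : ∀ T ∈ S.powersetCard k, a ∉ T := fun T hT h =>
    ha ((Finset.mem_powersetCard.1 hT).1 h)
  unfold esymmSum
  rw [Finset.powersetCard_succ_insert ha, Finset.sum_union, Finset.sum_image, Finset.mul_sum]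
  · congr 1
    exact Finset.sum_congr rfl fun T hT => Finset.prod_insert (haT T hT)
  · intro T hT T' hT' h
    rw [← Finset.erase_insert (haT T hT), ← Finset.erase_insert (haT T' hT'), h]
  · rw [Finset.disjoint_left]
    intro T hT hT'
    obtain ⟨U, -, rfl⟩ := Finset.mem_image.1 hT'
    exact ha ((Finset.mem_powersetCard.1 hT).1 (Finset.mem_insert_self a U))

/-- Multiplying an elementary symmetric sum of signs by the sum of the signs. -/
lemma sum_mul_esymmSum {ι : Type*} (S : Finset ι) (s : ι → ℝ) (hs : ∀ ℓ, s ℓ * s ℓ = 1)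
    (k : ℕ) :
    (∑ ℓ ∈ S, s ℓ) * esymmSum S s (k + 1) =
      (k + 2) * esymmSum S s (k + 2) + (S.card - k) * esymmSum S s k := by
  classical
  induction S using Finset.induction_on generalizing k with
  | empty =>
    have h : ∀ j, esymmSum ∅ s (j + 1) = 0 := fun j => by
      rw [esymmSum, Finset.powersetCard_eq_empty.2 (by simp), Finset.sum_empty]
    rcases k with _ | k <;> simp [h]
  | insert a S ha ih =>
    have h1 : esymmSum S s 1 = ∑ ℓ ∈ S, s ℓ := by
      simp [esymmSum, Finset.powersetCard_one]
    rw [Finset.sum_insert ha, Finset.card_insert_of_notMem ha, esymmSum_insert ha,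
      esymmSum_insert ha]
    rcases k with _ | k
    · have := ih 0
      simp only [esymmSum_zero, zero_add, h1] at this ⊢
      push_cast at this ⊢
      linear_combination this + hs a
    · rw [esymmSum_insert ha]
      have h2 := ih (k + 1)
      have h3 := ih k
      push_cast at h2 h3 ⊢
      linear_combination h2 + s a * h3 + esymmSum S s (k + 1) * hs a

lemma spin_mul_self {N : ℕ} (σ : Spin N) (j : Fin N) : spin σ j * spin σ j = 1 := by
  unfold spin
  split_ifs <;> norm_num

lemma spinProd_mul_self {N p : ℕ} (σ : Spin N) (i : Fin p → Fin N) :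
    spinProd σ i * spinProd σ i = 1 := by
  simp [spinProd, ← Finset.prod_mul_distrib, spin_mul_self]

lemma partitionZ_pos {N : ℕ} (H : Spin N → ℝ) : 0 < partitionZ H :=
  Finset.sum_pos (fun _ _ => Real.exp_pos _) Finset.univ_nonempty

lemma sum_gibbs {N : ℕ} (H : Spin N → ℝ) : ∑ τ, gibbs H τ = 1 := by
  simp only [gibbs, ← Finset.sum_div]
  exact div_self (partitionZ_pos H).ne'

/-- The one-replica Gibbs average of `σ_i`. -/
def magnetization {N p : ℕ} (H : Spin N → ℝ) (i : Fin p → Fin N) : ℝ :=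
  ∑ τ, spinProd τ i * gibbs H τ

lemma gibbs_hasDerivAt {N p : ℕ} (i : Fin p → Fin N) (c : ℝ) (H₀ : Spin N → ℝ)
    (σ : Spin N) (x : ℝ) :
    HasDerivAt (fun y : ℝ => gibbs (fun σ => H₀ σ + c * y * spinProd σ i) σ)
      (gibbs (fun σ => H₀ σ + c * x * spinProd σ i) σ *
        (c * (spinProd σ i - magnetization (fun σ => H₀ σ + c * x * spinProd σ i) i))) x := by
  have hexp : ∀ τ : Spin N, HasDerivAt (fun y : ℝ => Real.exp (H₀ τ + c * y * spinProd τ i))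
      (Real.exp (H₀ τ + c * x * spinProd τ i) * (c * spinProd τ i)) x := by
    intro τ
    have := (((hasDerivAt_id x).const_mul c).mul_const (spinProd τ i)).const_add (H₀ τ)
    simpa using this.exp
  have hZ := HasDerivAt.fun_sum (u := Finset.univ) fun τ _ => hexp τ
  have hpos := partitionZ_pos fun σ => H₀ σ + c * x * spinProd σ i
  have hmag : ∑ τ : Spin N, Real.exp (H₀ τ + c * x * spinProd τ i) * (c * spinProd τ i) =
      c * magnetization (fun σ => H₀ σ + c * x * spinProd σ i) i *
        partitionZ fun σ => H₀ σ + c * x * spinProd σ i := by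
    unfold magnetization
    rw [Finset.mul_sum, Finset.sum_mul]
    refine Finset.sum_congr rfl fun τ _ => ?_
    unfold gibbs
    field_simp
  rw [hmag] at hZ
  refine ((hexp σ).fun_div hZ hpos.ne').congr_deriv ?_
  change (_ * partitionZ (fun σ => H₀ σ + c * x * spinProd σ i) - _) /
    partitionZ (fun σ => H₀ σ + c * x * spinProd σ i) ^ 2 = _
  unfold gibbs
  field_simp

lemma magnetization_hasDerivAt {N p : ℕ} (i : Fin p → Fin N) (c : ℝ) (H₀ : Spin N → ℝ)
    (x : ℝ) :
    HasDerivAt (fun y : ℝ => magnetization (fun σ => H₀ σ + c * y * spinProd σ i) i)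
      (c * (1 - magnetization (fun σ => H₀ σ + c * x * spinProd σ i) i ^ 2)) x := by
  refine (HasDerivAt.fun_sum fun τ _ =>
    (gibbs_hasDerivAt i c H₀ τ x).const_mul (spinProd τ i)).congr_deriv ?_
  set H := fun σ => H₀ σ + c * x * spinProd σ i
  have h : ∀ τ, spinProd τ i * (gibbs H τ * (c * (spinProd τ i - magnetization H i))) =
      c * (gibbs H τ - magnetization H i * (spinProd τ i * gibbs H τ)) := fun τ => by
    linear_combination c * gibbs H τ * spinProd_mul_self τ i
  rw [Finset.sum_congr rfl fun τ _ => h τ, ← Finset.mul_sum, Finset.sum_sub_distrib, sum_gibbs,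
    ← Finset.mul_sum, sq]
  rfl

lemma gibbsExp_hasDerivAt {N n p : ℕ} (i : Fin p → Fin N) (c : ℝ) (H₀ : Spin N → ℝ)
    (f : (Fin n → Spin N) → ℝ) (x : ℝ) :
    HasDerivAt (fun y : ℝ => gibbsExp (fun σ => H₀ σ + c * y * spinProd σ i) f)
      (c * (gibbsExp (fun σ => H₀ σ + c * x * spinProd σ i)
          (fun σ => (∑ ℓ, spinProd (σ ℓ) i) * f σ) -
        n * magnetization (fun σ => H₀ σ + c * x * spinProd σ i) i *
          gibbsExp (fun σ => H₀ σ + c * x * spinProd σ i) f)) x := by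
  refine (HasDerivAt.fun_sum fun σ _ => (HasDerivAt.fun_finsetProd fun ℓ _ =>
    gibbs_hasDerivAt i c H₀ (σ ℓ) x).const_mul (f σ)).congr_deriv ?_
  unfold gibbsExp
  rw [Finset.mul_sum, ← Finset.sum_sub_distrib, Finset.mul_sum]
  refine Finset.sum_congr rfl fun σ _ => ?_
  set H := fun σ => H₀ σ + c * x * spinProd σ i
  have h : ∀ ℓ ∈ (Finset.univ : Finset (Fin n)),
      (∏ j ∈ Finset.univ.erase ℓ, gibbs H (σ j)) •
        (gibbs H (σ ℓ) * (c * (spinProd (σ ℓ) i - magnetization H i))) =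
      (∏ j, gibbs H (σ j)) * c * (spinProd (σ ℓ) i - magnetization H i) := fun ℓ hℓ => by
    rw [← Finset.prod_erase_mul _ _ hℓ, smul_eq_mul]
    ring
  rw [Finset.sum_congr rfl h, ← Finset.mul_sum, Finset.sum_sub_distrib]
  simp only [Finset.sum_const, Finset.card_univ, Fintype.card_fin, nsmul_eq_mul]
  ring

/-- The additional replicas are independent of the first `n`. -/
lemma gibbsExp_mul_prod_Ico {N n p q r : ℕ} (i : Fin p → Fin N) (H : Spin N → ℝ)
    (f : (Fin n → Spin N) → ℝ) (hr : r ≤ q) :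
    gibbsExp H (fun σ : Fin (n + q) → Spin N =>
        f (fun ℓ => σ (Fin.castAdd q ℓ)) *
          ∏ j ∈ Finset.Ico n (n + r), spinProd (extendReplicas σ j) i) =
      magnetization H i ^ r * gibbsExp H f := by
  have hprod : ∀ σ : Fin (n + q) → Spin N,
      ∏ j ∈ Finset.Ico n (n + r), spinProd (extendReplicas σ j) i =
        ∏ j : Fin q, if (j : ℕ) < r then spinProd (σ (Fin.natAdd n j)) i else 1 := by
    intro σ
    rw [Finset.prod_Ico_eq_prod_range, Nat.add_sub_cancel_left,
      Finset.prod_subset_one_on_sdiff (s₂ := Finset.range q)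
        (g := fun j => if j < r then spinProd (extendReplicas σ (n + j)) i else 1)
        (Finset.range_subset_range.2 hr), Finset.prod_range]
    · refine Finset.prod_congr rfl fun j _ => ?_
      simp [extendReplicas, Fin.natAdd]
    · intro j hj
      simp_all
    · intro j hj
      simp_all
  have hone : ∀ j : Fin q,
      ∑ τ : Spin N, (if (j : ℕ) < r then spinProd τ i else 1) * gibbs H τ =
        if (j : ℕ) < r then magnetization H i else 1 := by
    intro j
    split_ifs
    · rfl
    · simpa using sum_gibbs H
  have hpow : ∏ j : Fin q, (if (j : ℕ) < r then magnetization H i else 1) =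
      magnetization H i ^ r := by
    rw [← Finset.prod_range (fun j => if j < r then magnetization H i else 1),
      Finset.prod_ite, Finset.prod_const_one, mul_one, Finset.prod_const]
    congr 1
    rw [show Finset.filter (fun j => j < r) (Finset.range q) = Finset.range r by
      ext j; simp; omega, Finset.card_range]
  unfold gibbsExp
  simp only [hprod]
  rw [← (Fin.appendEquiv n q).sum_comp, Fintype.sum_prod_type, Finset.mul_sum]
  refine Finset.sum_congr rfl fun σ _ => ?_
  rw [← hpow, ← Finset.prod_congr rfl fun j _ => hone j, Fintype.prod_sum, Finset.sum_mul]
  refine Finset.sum_congr rfl fun τ _ => ?_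
  simp only [Fin.appendEquiv, Equiv.coe_fn_mk, Fin.append_left, Fin.append_right,
    Fin.prod_univ_add, Finset.prod_mul_distrib]
  ring

/-- The signed binomial coefficient `(-1)^j C(n+j-1, n-1)`. -/
def signedChoose (n j : ℕ) : ℝ := (-1) ^ j * (Nat.choose (n + j - 1) (n - 1) : ℝ)

lemma signedChoose_succ {n : ℕ} (hn : 1 ≤ n) (j : ℕ) :
    ((j : ℝ) + 1) * signedChoose n (j + 1) = -((n : ℝ) + j) * signedChoose n j := by
  obtain ⟨d, rfl⟩ := Nat.exists_eq_add_of_le' hn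
  have h := Nat.choose_mul_succ_eq (d + j) d
  rw [show d + j + 1 - d = j + 1 by omega] at h
  have h' : ((d + j).choose d : ℝ) * (d + j + 1) = ((d + j + 1).choose d : ℝ) * (j + 1) := by
    exact_mod_cast h
  unfold signedChoose
  rw [show d + 1 + (j + 1) - 1 = d + j + 1 by omega, show d + 1 + j - 1 = d + j by omega,
    Nat.add_sub_cancel, pow_succ]
  push_cast
  linear_combination (-1) ^ j * h'

/-- The Gibbs average of the `k`-th elementary symmetric sum of the replicas times `F`. -/
def esymmExp {N n p : ℕ} (i : Fin p → Fin N) (H : Spin N → ℝ) (F : (Fin n → Spin N) → ℝ)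
    (k : ℕ) : ℝ :=
  gibbsExp H fun σ => esymmSum Finset.univ (fun ℓ => spinProd (σ ℓ) i) k * F σ

lemma gibbsExp_Sfun {N n p q m : ℕ} (i : Fin p → Fin N) (H : Spin N → ℝ)
    (F : (Fin n → Spin N) → ℝ) (hm : 1 ≤ m) (hmq : m ≤ q) :
    gibbsExp H (fun σ : Fin (n + q) → Spin N =>
        Sfun i n (m : ℤ) (extendReplicas σ) * F fun ℓ => σ (Fin.castAdd q ℓ)) =
      (Nat.factorial m : ℝ) * ∑ k ∈ Finset.range (m + 1),
        signedChoose n (m - k) * magnetization H i ^ (m - k) * esymmExp i H F k := by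
  have hS : ∀ σ : Fin (n + q) → Spin N,
      Sfun i n (m : ℤ) (extendReplicas σ) * F (fun ℓ => σ (Fin.castAdd q ℓ)) =
        ∑ k ∈ Finset.range (m + 1), (Nat.factorial m : ℝ) * signedChoose n (m - k) *
          ((esymmSum Finset.univ (fun ℓ => spinProd (σ (Fin.castAdd q ℓ)) i) k *
              F fun ℓ => σ (Fin.castAdd q ℓ)) *
            ∏ j ∈ Finset.Ico n (n + (m - k)), spinProd (extendReplicas σ j) i) := by
    intro σ
    have hext : ∀ ℓ : Fin n, extendReplicas σ ℓ = σ (Fin.castAdd q ℓ) := fun ℓ => by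
      have : (ℓ : ℕ) < n + q := by omega
      simp [extendReplicas, this, Fin.castAdd, Fin.castLE]
    have hm' : (1 : ℤ) ≤ m := by exact_mod_cast hm
    simp only [Sfun, if_pos hm', Int.toNat_natCast, hext]
    rw [Finset.mul_sum, Finset.sum_mul]
    refine Finset.sum_congr rfl fun k hk => ?_
    rw [← Finset.sum_mul, Nat.add_sub_assoc (Nat.lt_succ_iff.1 (Finset.mem_range.1 hk))]
    simp only [signedChoose, esymmSum]
    ring
  simp only [hS, Finset.mul_sum]
  unfold gibbsExp
  simp only [Finset.sum_mul]
  rw [Finset.sum_comm]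
  refine Finset.sum_congr rfl fun k _ => ?_
  have h := gibbsExp_mul_prod_Ico (q := q) (r := m - k) i H
    (fun σ => esymmSum Finset.univ (fun ℓ => spinProd (σ ℓ) i) k * F σ) (by omega)
  change _ = _ * esymmExp i H F k at h
  rw [← mul_assoc, mul_assoc, mul_assoc, ← h, gibbsExp, Finset.mul_sum, Finset.mul_sum]
  exact Finset.sum_congr rfl fun σ _ => by ring

lemma esymmExp_hasDerivAt {N n p : ℕ} (i : Fin p → Fin N) (c : ℝ) (H₀ : Spin N → ℝ)
    (F : (Fin n → Spin N) → ℝ) (k : ℕ) (x : ℝ) :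
    HasDerivAt (fun y : ℝ => esymmExp i (fun σ => H₀ σ + c * y * spinProd σ i) F k)
      (c * ((k + 1) * esymmExp i (fun σ => H₀ σ + c * x * spinProd σ i) F (k + 1) +
          (if k = 0 then 0 else (n - k + 1) *
            esymmExp i (fun σ => H₀ σ + c * x * spinProd σ i) F (k - 1)) -
        n * magnetization (fun σ => H₀ σ + c * x * spinProd σ i) i *
          esymmExp i (fun σ => H₀ σ + c * x * spinProd σ i) F k)) x := by
  refine (gibbsExp_hasDerivAt i c H₀ _ x).congr_deriv ?_
  congr 2
  unfold esymmExp gibbsExp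
  rcases k with _ | k
  · simp [esymmSum, Finset.powersetCard_one]
  · rw [if_neg k.succ_ne_zero, Finset.mul_sum, Finset.mul_sum, ← Finset.sum_add_distrib]
    refine Finset.sum_congr rfl fun σ _ => ?_
    have h := sum_mul_esymmSum Finset.univ (fun ℓ => spinProd (σ ℓ) i)
      (fun ℓ => spinProd_mul_self _ i) k
    rw [Finset.card_univ, Fintype.card_fin] at h
    beta_reduce
    rw [← mul_assoc, h, Nat.add_sub_cancel]
    push_cast
    ring

/-- The algebraic identity behind the differential equation for `⟨S_i^{m,n} F⟩`. -/
lemma sum_signedChoose_identity {n : ℕ} (hn : 1 ≤ n) (a : ℕ → ℝ) (t : ℝ) (r : ℕ) :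
    ∑ k ∈ Finset.range (r + 2),
      (signedChoose n (r + 1 - k) *
          (((r + 1 - k : ℕ) : ℝ) * t ^ (r + 1 - k - 1) * (1 - t ^ 2)) * a k +
        signedChoose n (r + 1 - k) * t ^ (r + 1 - k) *
          ((k + 1) * a (k + 1) + (if k = 0 then 0 else (n - k + 1) * a (k - 1)) -
            n * t * a k)) =
      -(r : ℝ) * ∑ k ∈ Finset.range (r + 1), signedChoose n (r - k) * t ^ (r - k) * a k +
        (r + 2) * ∑ k ∈ Finset.range (r + 3),
          signedChoose n (r + 2 - k) * t ^ (r + 2 - k) * a k := by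
  have hup : ∑ k ∈ Finset.range (r + 2),
      signedChoose n (r + 1 - k) * t ^ (r + 1 - k) * ((k + 1) * a (k + 1)) =
      ∑ k ∈ Finset.range (r + 3),
        signedChoose n (r + 2 - k) * t ^ (r + 2 - k) * (k * a k) := by
    rw [Finset.sum_range_succ' _ (r + 2)]
    simp
  have hdown : ∑ k ∈ Finset.range (r + 2), signedChoose n (r + 1 - k) * t ^ (r + 1 - k) *
        (if k = 0 then 0 else (n - k + 1) * a (k - 1)) =
      ∑ k ∈ Finset.range (r + 1),
        signedChoose n (r - k) * t ^ (r - k) * ((n - k) * a k) := by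
    rw [Finset.sum_range_succ' _ (r + 1)]
    simp [← sub_sub]
  have hlow : ∑ k ∈ Finset.range (r + 2),
        signedChoose n (r + 1 - k) * ((r + 1 - k : ℕ) : ℝ) * t ^ (r + 1 - k - 1) * a k =
      ∑ k ∈ Finset.range (r + 1),
        -((n : ℝ) + r - k) * signedChoose n (r - k) * t ^ (r - k) * a k := by
    rw [Finset.sum_range_succ _ (r + 1)]
    simp only [Nat.sub_self, Nat.cast_zero, mul_zero, zero_mul, add_zero]
    refine Finset.sum_congr rfl fun k hk => ?_
    have hk' : k ≤ r := Nat.lt_succ_iff.1 (Finset.mem_range.1 hk)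
    have h := signedChoose_succ hn (r - k)
    rw [show r + 1 - k = r - k + 1 by omega, Nat.add_sub_cancel]
    push_cast [hk'] at h ⊢
    linear_combination t ^ (r - k) * a k * h
  have hhigh : ∑ k ∈ Finset.range (r + 2),
        (-signedChoose n (r + 1 - k) * ((r + 1 - k : ℕ) : ℝ) * t ^ (r + 1 - k - 1) * t ^ 2 * a k
          - signedChoose n (r + 1 - k) * t ^ (r + 1 - k) * (n * t * a k)) =
      ∑ k ∈ Finset.range (r + 3),
        (r + 2 - k : ℝ) * signedChoose n (r + 2 - k) * t ^ (r + 2 - k) * a k := by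
    rw [Finset.sum_range_succ _ (r + 2)]
    have h0 : (r + 2 - ((r + 2 : ℕ) : ℝ)) = 0 := by push_cast; ring
    rw [h0]
    simp only [zero_mul, add_zero]
    refine Finset.sum_congr rfl fun k hk => ?_
    have hk' : k ≤ r + 1 := Nat.lt_succ_iff.1 (Finset.mem_range.1 hk)
    have h := signedChoose_succ hn (r + 1 - k)
    rw [show r + 2 - k = r + 1 - k + 1 by omega]
    have ht : ((r + 1 - k : ℕ) : ℝ) * t ^ (r + 1 - k - 1) * t ^ 2 =
        ((r + 1 - k : ℕ) : ℝ) * t ^ (r + 1 - k + 1) := by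
      rcases Nat.eq_zero_or_pos (r + 1 - k) with h | h
      · simp [h]
      · rw [mul_assoc, ← pow_add, show r + 1 - k - 1 + 2 = r + 1 - k + 1 by omega]
    have hc : ((r + 1 - k : ℕ) : ℝ) = r + 1 - k := by push_cast [hk']; ring
    rw [hc] at h ht ⊢
    linear_combination (-signedChoose n (r + 1 - k) * a k) * ht - t ^ (r + 1 - k + 1) * a k * h
  calc _ = (∑ k ∈ Finset.range (r + 2),
          signedChoose n (r + 1 - k) * ((r + 1 - k : ℕ) : ℝ) * t ^ (r + 1 - k - 1) * a k) +
        (∑ k ∈ Finset.range (r + 2),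
          (-signedChoose n (r + 1 - k) * ((r + 1 - k : ℕ) : ℝ) * t ^ (r + 1 - k - 1) * t ^ 2 *
            a k - signedChoose n (r + 1 - k) * t ^ (r + 1 - k) * (n * t * a k))) +
        (∑ k ∈ Finset.range (r + 2),
          signedChoose n (r + 1 - k) * t ^ (r + 1 - k) * ((k + 1) * a (k + 1))) +
        ∑ k ∈ Finset.range (r + 2), signedChoose n (r + 1 - k) * t ^ (r + 1 - k) *
          (if k = 0 then 0 else (n - k + 1) * a (k - 1)) := by
        simp only [← Finset.sum_add_distrib]
        exact Finset.sum_congr rfl fun k _ => by ring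
    _ = _ := by
        rw [hup, hdown, hlow, hhigh]
        have hsub : ∑ k ∈ Finset.range (r + 1),
              -((n : ℝ) + r - k) * signedChoose n (r - k) * t ^ (r - k) * a k +
            ∑ k ∈ Finset.range (r + 1), signedChoose n (r - k) * t ^ (r - k) * ((n - k) * a k) =
            -(r : ℝ) * ∑ k ∈ Finset.range (r + 1),
              signedChoose n (r - k) * t ^ (r - k) * a k := by
          rw [← Finset.sum_add_distrib, Finset.mul_sum]
          exact Finset.sum_congr rfl fun k _ => by ring
        have hadd : ∑ k ∈ Finset.range (r + 3),
              (r + 2 - k : ℝ) * signedChoose n (r + 2 - k) * t ^ (r + 2 - k) * a k +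
            ∑ k ∈ Finset.range (r + 3),
              signedChoose n (r + 2 - k) * t ^ (r + 2 - k) * (k * a k) =
            (r + 2) * ∑ k ∈ Finset.range (r + 3),
              signedChoose n (r + 2 - k) * t ^ (r + 2 - k) * a k := by
          rw [← Finset.sum_add_distrib, Finset.mul_sum]
          exact Finset.sum_congr rfl fun k _ => by ring
        linear_combination hsub + hadd

/-- The differential equation (4.13): with `H_x(σ) = H₀(σ) + c x σ_i`, for every `m ≥ 1`,
`d/dx ⟨S_i^{m,n} F⟩_{H_x} = c (-m(m-1) ⟨S_i^{m-1,n} F⟩_{H_x} + ⟨S_i^{m+1,n} F⟩_{H_x})`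
(all Gibbs expectations taken with `n + m + 1` replicas). -/
theorem gibbsExp_Sfun_hasDerivAt {N n p : ℕ} (hn : 1 ≤ n) (hp : 2 ≤ p)
    (i : Fin p → Fin N) (c : ℝ) (H₀ : Spin N → ℝ) (F : (Fin n → Spin N) → ℝ)
    (m : ℕ) (hm : 1 ≤ m) (x : ℝ) :
    HasDerivAt
      (fun y : ℝ => gibbsExp (fun σ => H₀ σ + c * y * spinProd σ i)
        (fun σ : Fin (n + m + 1) → Spin N =>
          Sfun i n (m : ℤ) (extendReplicas σ) * F fun ℓ => σ ⟨ℓ, by omega⟩))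
      (c * (-((m : ℝ) * ((m : ℝ) - 1)) *
          gibbsExp (fun σ => H₀ σ + c * x * spinProd σ i)
            (fun σ : Fin (n + m + 1) → Spin N =>
              Sfun i n ((m : ℤ) - 1) (extendReplicas σ) * F fun ℓ => σ ⟨ℓ, by omega⟩)
        + gibbsExp (fun σ => H₀ σ + c * x * spinProd σ i)
            (fun σ : Fin (n + m + 1) → Spin N =>
              Sfun i n ((m : ℤ) + 1) (extendReplicas σ) * F fun ℓ => σ ⟨ℓ, by omega⟩)))
      x := by
  obtain ⟨r, rfl⟩ := Nat.exists_eq_add_of_le' hm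
  set H := fun σ => H₀ σ + c * x * spinProd σ i
  have hfun : ∀ y : ℝ, _ := fun y => gibbsExp_Sfun (q := r + 1 + 1) i
    (fun σ => H₀ σ + c * y * spinProd σ i) F (Nat.le_add_left 1 r) (Nat.le_succ (r + 1))
  have hsucc := gibbsExp_Sfun (q := r + 1 + 1) i H F (m := r + 2) (by omega) le_rfl
  have hpred : (r : ℝ) * gibbsExp H (fun σ : Fin (n + (r + 1 + 1)) → Spin N =>
        Sfun i n (r : ℤ) (extendReplicas σ) * F fun ℓ => σ (Fin.castAdd _ ℓ)) =
      r * ((Nat.factorial r : ℝ) * ∑ k ∈ Finset.range (r + 1),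
        signedChoose n (r - k) * magnetization H i ^ (r - k) * esymmExp i H F k) := by
    rcases Nat.eq_zero_or_pos r with rfl | hr
    · simp
    · rw [gibbsExp_Sfun i H F hr (by omega)]
  have hderiv := (HasDerivAt.fun_sum (u := Finset.range (r + 2)) fun k _ =>
    (((magnetization_hasDerivAt i c H₀ x).fun_pow (r + 1 - k)).const_mul
      (signedChoose n (r + 1 - k))).fun_mul
        (esymmExp_hasDerivAt i c H₀ F k x)).const_mul (Nat.factorial (r + 1) : ℝ)
  rw [show (fun σ => H₀ σ + c * x * spinProd σ i) = H from rfl] at hderiv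
  have hid := sum_signedChoose_identity hn (esymmExp i H F) (magnetization H i) r
  refine (hderiv.congr_of_eventuallyEq (Eventually.of_forall hfun)).congr_deriv ?_
  have h1 : ((r + 1 : ℕ) : ℤ) - 1 = r := by push_cast; ring
  have h2 : ((r + 1 : ℕ) : ℤ) + 1 = (r + 2 : ℕ) := by push_cast; ring
  rw [h1, h2]
  change _ = c * (-(((r + 1 : ℕ) : ℝ) * (((r + 1 : ℕ) : ℝ) - 1)) *
    gibbsExp H (fun σ : Fin (n + (r + 1 + 1)) → Spin N =>
        Sfun i n (r : ℤ) (extendReplicas σ) * F fun ℓ => σ (Fin.castAdd _ ℓ)) +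
    gibbsExp H (fun σ : Fin (n + (r + 1 + 1)) → Spin N =>
        Sfun i n ((r + 2 : ℕ) : ℤ) (extendReplicas σ) * F fun ℓ => σ (Fin.castAdd _ ℓ)))
  rw [hsucc]
  have hf1 : (Nat.factorial (r + 1) : ℝ) = (r + 1) * Nat.factorial r := by
    rw [Nat.factorial_succ]; push_cast; ring
  have hf2 : (Nat.factorial (r + 2) : ℝ) = (r + 2) * ((r + 1) * Nat.factorial r) := by
    rw [Nat.factorial_succ, Nat.factorial_succ]; push_cast; ring
  rw [hf1, hf2]
  push_cast
  trans (r + 1) * Nat.factorial r * (c * (-(r : ℝ) * ∑ k ∈ Finset.range (r + 1),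
      signedChoose n (r - k) * magnetization H i ^ (r - k) * esymmExp i H F k +
    (r + 2) * ∑ k ∈ Finset.range (r + 3),
      signedChoose n (r + 2 - k) * magnetization H i ^ (r + 2 - k) * esymmExp i H F k))
  · rw [← hid]
    congr 1
    rw [Finset.mul_sum]
    exact Finset.sum_congr rfl fun k _ => by ring
  · linear_combination c * ((r : ℝ) + 1) * hpred
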